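/- arXiv:2209.01954 — 5 statements merged into one kernel-verified Lean document; each statement's English description precedes it below -/
import Mathlib

section
/- Suppose f : ℝⁿ → ℝ is a nonzero polynomial. Then for any positive real numbers h₁,…,hₙ there exist ε > 0 and M₁,…,Mₙ > 0 such that |f(x)| ≥ ε for all x ∈ [M₁, M₁ + h₁] × ⋯ × [Mₙ, Mₙ + hₙ]. -/
/-- A real polynomial whose coefficient in top degree `d` is at least `ε` in absolute value is at
least `ε / 2` in absolute value at points large compared with the lower coefficients. -/
lemma Polynomial.half_le_abs_eval_of_le_abs_coeff {p : Polynomial ℝ} {d : ℕ} {ε B y : ℝ}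
    (hd : p.natDegree ≤ d) (hε : 0 < ε) (hlead : ε ≤ |p.coeff d|)
    (hB : ∑ i ∈ Finset.range d, |p.coeff i| ≤ B) (hy : 1 ≤ y) (hBy : 2 * B ≤ ε * y) :
    ε / 2 ≤ |p.eval y| := by
  have hy0 : 0 < y := one_pos.trans_le hy
  have hyd : 1 ≤ y ^ d := one_le_pow₀ hy
  set tail := ∑ i ∈ Finset.range d, p.coeff i * y ^ i
  have heval : p.eval y = tail + p.coeff d * y ^ d := by
    rw [Polynomial.eval_eq_sum_range' (Nat.lt_succ_of_le hd), Finset.sum_range_succ]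
  have htail_le : |tail| * y ≤ B * y ^ d :=
    calc |tail| * y ≤ (∑ i ∈ Finset.range d, |p.coeff i * y ^ i|) * y := by
          gcongr
          exact Finset.abs_sum_le_sum_abs _ _
      _ = ∑ i ∈ Finset.range d, |p.coeff i| * y ^ (i + 1) := by
          rw [Finset.sum_mul]
          refine Finset.sum_congr rfl fun i _ => ?_
          rw [abs_mul, abs_of_pos (pow_pos hy0 i), pow_succ, mul_assoc]
      _ ≤ ∑ i ∈ Finset.range d, |p.coeff i| * y ^ d := by
          gcongr with i hi
          exact Finset.mem_range.mp hi
      _ ≤ B * y ^ d := by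
          rw [← Finset.sum_mul]
          gcongr
  have htail_half : |tail| ≤ ε / 2 * y ^ d := by
    refine le_of_mul_le_mul_right (htail_le.trans ?_) hy0
    nlinarith
  have hmain : ε * y ^ d ≤ |p.coeff d * y ^ d| := by
    rw [abs_mul, abs_of_pos (pow_pos hy0 d)]
    gcongr
  have htri : |p.coeff d * y ^ d| - |tail| ≤ |p.eval y| := by
    rw [heval, add_comm]
    simpa using abs_sub_abs_le_abs_sub (p.coeff d * y ^ d) (-tail)
  nlinarith

/-- A nonzero real polynomial in `n` variables is, for any box side lengths
`h₁, …, hₙ > 0`, bounded below in absolute value by some `ε > 0` on some box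
`[M₁, M₁ + h₁] × ⋯ × [Mₙ, Mₙ + hₙ]` with all `Mᵢ > 0`. -/
theorem nonzero_poly_bounded_below_on_far_box (n : ℕ) (f : MvPolynomial (Fin n) ℝ)
    (hf : f ≠ 0) (h : Fin n → ℝ) (hh : ∀ i, 0 < h i) :
    ∃ ε > (0:ℝ), ∃ M : Fin n → ℝ, (∀ i, 0 < M i) ∧
      ∀ x : Fin n → ℝ, (∀ i, x i ∈ Set.Icc (M i) (M i + h i)) →
        ε ≤ |MvPolynomial.eval x f| := by
  induction n with
  | zero =>
    refine ⟨|MvPolynomial.eval 0 f|, abs_pos.mpr fun h0 => hf ?_, 1, fun i => i.elim0,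
      fun x _ => by rw [Subsingleton.elim x 0]⟩
    exact MvPolynomial.funext fun x => by rw [Subsingleton.elim x 0, h0, map_zero]
  | succ n ih =>
    set F := MvPolynomial.finSuccEquiv ℝ n f
    have hF0 : F ≠ 0 := (map_ne_zero_iff _ (MvPolynomial.finSuccEquiv ℝ n).injective).mpr hf
    obtain ⟨ε, hε, M, hM, hlead⟩ := ih F.leadingCoeff (Polynomial.leadingCoeff_ne_zero.mpr hF0)
      (fun i => h i.succ) fun i => hh i.succ
    have hcompact : IsCompact (Set.Icc M fun i => M i + h i.succ) := isCompact_Icc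
    obtain ⟨B, hB⟩ := hcompact.bddAbove_image
      (f := fun s => ∑ i ∈ Finset.range F.natDegree, |MvPolynomial.eval s (F.coeff i)|)
      (continuous_finsetSum _ fun i _ => (MvPolynomial.continuous_eval _).abs).continuousOn
    refine ⟨ε / 2, half_pos hε, Fin.cons (max 1 (2 * B / ε)) M,
      Fin.cases (by simp) (by simpa using hM), fun x hx => ?_⟩
    have hx0 : max 1 (2 * B / ε) ≤ x 0 := by simpa using (hx 0).1
    have hxs : ∀ i : Fin n, x i.succ ∈ Set.Icc (M i) (M i + h i.succ) := fun i => by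
      simpa using hx i.succ
    have heval : MvPolynomial.eval x f =
        (F.map (MvPolynomial.eval fun i => x i.succ)).eval (x 0) := by
      conv_lhs => rw [← Fin.cons_self_tail x]
      exact MvPolynomial.eval_eq_eval_mv_eval' _ _ _
    rw [heval]
    refine Polynomial.half_le_abs_eval_of_le_abs_coeff Polynomial.natDegree_map_le hε
      (B := B) ?_ ?_ ((le_max_left _ _).trans hx0) ?_
    · simpa only [Polynomial.coeff_map, Polynomial.coeff_natDegree] using hlead _ hxs
    · simp only [Polynomial.coeff_map]
      exact hB ⟨_, ⟨fun i => (hxs i).1, fun i => (hxs i).2⟩, rfl⟩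
    · rw [← div_le_iff₀' hε]
      exact (le_max_right _ _).trans hx0
end

section
/- Let n ≥ 1, 0 ≤ p ≤ n, k ≥ 1 an integer, and I ⊆ {1,…,n} with |I| = p. Let f : ℝⁿ → ℝ be a polynomial whose degree in x_i is at most k − 1 for i ∈ I and at most k for i ∉ I. For v ∈ ℝⁿ define F(v) = ∫_{[0,1/k]^I} f(w(x,v)) dx, where w(x,v) is the point of ℝⁿ whose i-th coordinate is v_i + x_i if i ∈ I and v_i if i ∉ I, and the integral is the p-dimensional Lebesgue integral over the cube [0, 1/k]^I in the variables (x_i)_{i∈I}. If F(v) = 0 for every v with v_i ∈ {0, 1/k, 2/k, …, (k−1)/k} for i ∈ I and v_i ∈ {0, 1/k, 2/k, …, (k−1)/k, 1} for i ∉ I, then f is the zero polynomial. -/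
open MeasureTheory

/-- Tensor products of unisolvent one-variable functionals are unisolvent: `A i a m` is the value
on `X ^ m` of the `a`-th functional acting in the variable `i`. -/
theorem MvPolynomial.eq_zero_of_forall_sum_coeff_mul_prod_eq_zero {ι K : Type*} [Fintype ι]
    [Field K] (d : ι → ℕ) (A : ∀ i, Fin (d i) → ℕ → K)
    (hA : ∀ i (c : Fin (d i) → K), (∀ a, ∑ b : Fin (d i), A i a b * c b = 0) → c = 0)
    (f : MvPolynomial ι K) (hd : ∀ i, ∀ s ∈ f.support, s i < d i)
    (hf : ∀ j : ∀ i, Fin (d i), ∑ s ∈ f.support, f.coeff s * ∏ i, A i (j i) (s i) = 0) :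
    f = 0 := by
  classical
  have hdual : ∀ i (t : ℕ), t < d i → ∃ w : Fin (d i) → K, ∀ m < d i,
      ∑ j, w j * A i j m = if t = m then 1 else 0 := by
    intro i t ht
    let M : Matrix (Fin (d i)) (Fin (d i)) K := Matrix.of fun a b => A i a b
    have hM : IsUnit M := by
      rw [← Matrix.mulVec_injective_iff_isUnit]
      refine (injective_iff_map_eq_zero M.mulVecLin).2 fun c hc => hA i c fun a => ?_
      exact congrFun hc a
    refine ⟨M⁻¹ ⟨t, ht⟩, fun m hm => ?_⟩
    have h := congrFun (congrFun
      (Matrix.nonsing_inv_mul M ((Matrix.isUnit_iff_isUnit_det M).1 hM)) ⟨t, ht⟩) ⟨m, hm⟩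
    simpa [Matrix.mul_apply, Matrix.one_apply, M] using h
  ext t
  rw [MvPolynomial.coeff_zero]
  by_contra hne
  have ht : t ∈ f.support := MvPolynomial.mem_support_iff.2 hne
  choose w hw using fun i => hdual i (t i) (hd i t ht)
  apply hne
  calc f.coeff t = ∑ s ∈ f.support, f.coeff s * ∏ i, ∑ j, w i j * A i j (s i) := by
        rw [Finset.sum_eq_single_of_mem t ht]
        · rw [Finset.prod_eq_one fun i _ => by rw [hw i _ (hd i t ht), if_pos rfl], mul_one]
        · intro s hs hst
          obtain ⟨i, hi⟩ := Finsupp.ne_iff.1 hst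
          rw [Finset.prod_eq_zero (Finset.mem_univ i), mul_zero]
          rw [hw i _ (hd i s hs), if_neg (Ne.symm hi)]
    _ = ∑ j : ∀ i, Fin (d i), (∏ i, w i (j i)) *
          ∑ s ∈ f.support, f.coeff s * ∏ i, A i (j i) (s i) := by
        simp_rw [Fintype.prod_sum, Finset.prod_mul_distrib, Finset.mul_sum]
        rw [Finset.sum_comm]
        exact Finset.sum_congr rfl fun _ _ => Finset.sum_congr rfl fun _ _ => by ring
    _ = 0 := by simp [hf]

/-- A polynomial of degree less than `m` vanishing at `m` distinct points has zero coefficients. -/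
theorem eq_zero_of_forall_sum_pow_mul_eq_zero {K : Type*} [Field K] {m : ℕ} {x : Fin m → K}
    (hx : Function.Injective x) {c : Fin m → K} (h : ∀ a, ∑ b : Fin m, x a ^ (b : ℕ) * c b = 0) :
    c = 0 :=
  Matrix.eq_zero_of_mulVec_eq_zero (Matrix.det_vandermonde_ne_zero_iff.2 hx) (funext h)

theorem natCast_div_injective {k : ℕ} (hk : k ≠ 0) (m : ℕ) :
    Function.Injective fun a : Fin m => (a : ℝ) / k := by
  intro a b hab
  have hk' : (k : ℝ) ≠ 0 := Nat.cast_ne_zero.2 hk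
  exact Fin.ext (Nat.cast_injective (R := ℝ) ((div_left_inj' hk').1 hab))

theorem setIntegral_Icc_add_pow (v h : ℝ) (hh : 0 ≤ h) (m : ℕ) :
    ∫ x in Set.Icc 0 h, (v + x) ^ m = ((v + h) ^ (m + 1) - v ^ (m + 1)) / (m + 1) := by
  rw [integral_Icc_eq_integral_Ioc, ← intervalIntegral.integral_of_le hh,
    intervalIntegral.integral_comp_add_left (fun y => y ^ m), integral_pow, add_zero]

/-- A polynomial of degree less than `k` is determined by its integrals over the `k` intervals
`[a / k, (a + 1) / k]`: its antiderivative takes the same value at all the `k + 1` end points. -/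
theorem eq_zero_of_forall_sum_integral_pow_mul_eq_zero {k : ℕ} (hk : k ≠ 0) {c : Fin k → ℝ}
    (h : ∀ a : Fin k,
      ∑ b : Fin k, (∫ x in Set.Icc (0 : ℝ) (1 / k), ((a : ℝ) / k + x) ^ (b : ℕ)) * c b = 0) :
    c = 0 := by
  let Q : ℝ → ℝ := fun x => ∑ b : Fin k, x ^ ((b : ℕ) + 1) * (c b / (b + 1))
  have hstep : ∀ a < k, Q ((a + 1 : ℕ) / k) = Q ((a : ℝ) / k) := by
    intro a ha
    rw [← sub_eq_zero, ← h ⟨a, ha⟩, ← Finset.sum_sub_distrib]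
    refine Finset.sum_congr rfl fun b _ => ?_
    rw [setIntegral_Icc_add_pow _ _ (by positivity), ← add_div]
    push_cast
    ring
  have hQ : ∀ a ≤ k, Q ((a : ℝ) / k) = 0 := by
    intro a
    induction a with
    | zero => intro _; simp [Q]
    | succ a ih => intro ha; rw [hstep a ha, ih (Nat.le_of_succ_le ha)]
  have hvan : (Fin.cons 0 fun b : Fin k => c b / (b + 1) : Fin (k + 1) → ℝ) = 0 := by
    refine eq_zero_of_forall_sum_pow_mul_eq_zero (natCast_div_injective hk (k + 1)) fun a => ?_
    rw [Fin.sum_univ_succ]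
    simpa [Q] using hQ a (Nat.lt_succ_iff.1 a.2)
  ext b
  have hb := congrFun hvan b.succ
  rw [Fin.cons_succ, Pi.zero_apply, div_eq_zero_iff] at hb
  exact hb.resolve_right (by positivity)

theorem Finset.prod_dite_mem {ι M : Type*} [Fintype ι] [DecidableEq ι] [CommMonoid M]
    (I : Finset ι) (f : {i // i ∈ I} → M) (g : ι → M) :
    ∏ i, (if hi : i ∈ I then f ⟨i, hi⟩ else g i) = (∏ i, f i) * ∏ i : {i // i ∉ I}, g i := by
  rw [Fintype.prod_dite]
  congr!

/-- Integrating a polynomial over a translated cube in the variables of `I` splits, monomial by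
monomial, into one-variable integrals and evaluations. -/
theorem MvPolynomial.setIntegral_eval_translate {ι : Type*} [Fintype ι] [DecidableEq ι]
    (I : Finset ι) (f : MvPolynomial ι ℝ) (v : ι → ℝ) (h : ℝ) :
    ∫ x : {i // i ∈ I} → ℝ in Set.univ.pi (fun _ => Set.Icc (0:ℝ) h),
        MvPolynomial.eval (fun i => if hi : i ∈ I then v i + x ⟨i, hi⟩ else v i) f =
      ∑ s ∈ f.support, f.coeff s *
        ∏ i, if i ∈ I then ∫ x in Set.Icc (0 : ℝ) h, (v i + x) ^ s i else v i ^ s i := by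
  simp_rw [MvPolynomial.eval_eq']
  rw [integral_finsetSum]
  · refine Finset.sum_congr rfl fun s _ => ?_
    rw [integral_const_mul]
    congr 1
    have hsplit : ∀ x : {i // i ∈ I} → ℝ,
        ∏ i, (if hi : i ∈ I then v i + x ⟨i, hi⟩ else v i) ^ s i =
          (∏ i : {i // i ∈ I}, (v i + x i) ^ s i) * ∏ i : {i // i ∉ I}, v i ^ s i := by
      intro x
      rw [← Finset.prod_dite_mem I (fun i => (v i + x i) ^ s i) fun i => v i ^ s i]
      exact Finset.prod_congr rfl fun i _ => by split_ifs <;> rfl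
    simp_rw [hsplit]
    rw [integral_mul_const, volume_pi, Measure.restrict_pi_pi,
      integral_fintype_prod_eq_prod (fun (i : {i // i ∈ I}) (y : ℝ) => (v i + y) ^ s i)]
    exact (Finset.prod_dite_mem I (fun i => ∫ x in Set.Icc (0 : ℝ) h, (v i + x) ^ s i)
      fun i => v i ^ s i).symm
  · intro s _
    refine ContinuousOn.integrableOn_compact
      (isCompact_univ_pi fun _ => isCompact_Icc) (Continuous.continuousOn ?_)
    refine continuous_const.mul (continuous_finsetProd _ fun i _ => Continuous.pow ?_ _)
    split_ifs <;> fun_prop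

/-- **unisolvence.** Let `n ≥ 1`, `p ≤ n`, `k ≥ 1`, `I ⊆ {1,…,n}` with
`|I| = p`, and let `f` be a polynomial of degree at most `k − 1` in `xᵢ` for `i ∈ I`
and at most `k` in `xᵢ` for `i ∉ I`.  For `v ∈ ℝⁿ` let
`F v = ∫_{[0,1/k]^I} f(w(x,v)) dx`, where `w(x,v)ᵢ = vᵢ + xᵢ` for `i ∈ I` and
`w(x,v)ᵢ = vᵢ` otherwise, a `p`-dimensional Lebesgue integral.  If `F v = 0` for every
`v` with `vᵢ ∈ {0, 1/k, …, (k−1)/k}` for `i ∈ I` and `vᵢ ∈ {0, 1/k, …, (k−1)/k, 1}`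
for `i ∉ I`, then `f = 0`. -/
theorem unisolvence_small_cubes (n p k : ℕ) (hn : 1 ≤ n) (hp : p ≤ n) (hk : 1 ≤ k)
    (I : Finset (Fin n)) (hI : I.card = p)
    (f : MvPolynomial (Fin n) ℝ)
    (hdeg : ∀ i, f.degreeOf i ≤ if i ∈ I then k - 1 else k)
    (F : (Fin n → ℝ) → ℝ)
    (hF : ∀ v : Fin n → ℝ,
      F v = ∫ x : {i // i ∈ I} → ℝ in Set.univ.pi (fun _ => Set.Icc (0:ℝ) (1 / k)),
        MvPolynomial.eval (fun i => if h : i ∈ I then v i + x ⟨i, h⟩ else v i) f)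
    (hzero : ∀ v : Fin n → ℝ,
      (∀ i ∈ I, ∃ j : ℕ, j < k ∧ v i = (j : ℝ) / k) →
      (∀ i ∉ I, ∃ j : ℕ, j ≤ k ∧ v i = (j : ℝ) / k) →
      F v = 0) :
    f = 0 := by
  have hk' : k ≠ 0 := Nat.one_le_iff_ne_zero.1 hk
  refine MvPolynomial.eq_zero_of_forall_sum_coeff_mul_prod_eq_zero
    (fun i => if i ∈ I then k else k + 1)
    (fun i a m => if i ∈ I then ∫ x in Set.Icc (0 : ℝ) (1 / k), ((a : ℝ) / k + x) ^ m
      else ((a : ℝ) / k) ^ m) ?_ f ?_ ?_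
  · intro i
    by_cases hi : i ∈ I
    · simp only [hi, if_true]
      have hd : (if i ∈ I then k else k + 1) = k := if_pos hi
      generalize (if i ∈ I then k else k + 1) = d at hd ⊢
      subst d
      exact fun c => eq_zero_of_forall_sum_integral_pow_mul_eq_zero hk'
    · simp only [hi, if_false]
      have hd : (if i ∈ I then k else k + 1) = k + 1 := if_neg hi
      generalize (if i ∈ I then k else k + 1) = d at hd ⊢
      subst d
      exact fun c => eq_zero_of_forall_sum_pow_mul_eq_zero (natCast_div_injective hk' (k + 1))
  · intro i s hs
    have h := (MvPolynomial.monomial_le_degreeOf i hs).trans (hdeg i)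
    split_ifs at h ⊢ <;> omega
  · intro j
    rw [← MvPolynomial.setIntegral_eval_translate I f (fun i => (j i : ℝ) / k), ← hF]
    refine hzero _ (fun i hi => ⟨j i, ?_, rfl⟩) fun i hi => ⟨j i, ?_, rfl⟩
    · simpa [hi] using (j i).2
    · simpa [hi, Nat.lt_succ_iff] using (j i).2
end

section
/- Let σ ⊂ ℝⁿ be an n-parallelotope, i.e. σ = { x₀ + Σ_{k=1}^{n} λ_k v_k : 0 ≤ λ_k ≤ 1 } for some point x₀ and linearly independent vectors v₁,…,vₙ ∈ ℝⁿ. Then there exists a closed Euclidean ball B ⊆ σ with diameter diam(B) = Θ(σ) · diam(σ), where Θ(σ) = |σ| / diam(σ)ⁿ, |σ| is the n-dimensional Lebesgue measure of σ, and diam(σ) is its Euclidean diameter. -/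
open Metric MeasureTheory

/-- Cramer's rule for a top-degree alternating form. -/
lemma AlternatingMap.map_update_basis_eq_repr_mul {ι R M : Type*} [CommRing R] [AddCommGroup M]
    [Module R M] [Fintype ι] [DecidableEq ι] (ω : M [⋀^ι]→ₗ[R] R) (b : Module.Basis ι R M)
    (i : ι) (y : M) : ω (Function.update b i y) = b.repr y i * ω b := by
  have h : ω.toMultilinearMap.toLinearMap b i = (b.coord i).smulRight (ω b) := by
    refine b.ext fun j => ?_
    by_cases hij : j = i
    · subst hij
      simp
    · have := ω.map_update_self b (Ne.symm hij)
      simp [this, hij]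
  simpa using LinearMap.congr_fun h y

/-- The translate of the parallelepiped spanned by `v` has volume `|ω v|`, where `ω` is the volume
form of an orientation. -/
lemma Orientation.volume_image_add_sum {n : ℕ} {E : Type*} [NormedAddCommGroup E]
    [InnerProductSpace ℝ E] [MeasurableSpace E] [BorelSpace E] [Fact (Module.finrank ℝ E = n)]
    [FiniteDimensional ℝ E] (o : Orientation ℝ E (Fin n)) (x₀ : E) (v : Fin n → E) :
    volume ((fun lam : Fin n → ℝ => x₀ + ∑ i, lam i • v i) '' {lam | ∀ i, lam i ∈ Set.Icc (0:ℝ) 1})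
      = ENNReal.ofReal |o.volumeForm v| := by
  have h : (fun lam : Fin n → ℝ => x₀ + ∑ i, lam i • v i) '' {lam | ∀ i, lam i ∈ Set.Icc (0:ℝ) 1}
      = (fun y => x₀ + y) '' parallelepiped v := by
    rw [parallelepiped, Set.image_image]
    congr 1
    ext lam
    simp [Pi.le_def, forall_and]
  rw [h, Set.image_add_left, measure_preimage_add, ← o.measure_eq_volume,
    AlternatingMap.measure_parallelepiped]

/-- Every `n`-parallelotope `σ ⊆ ℝⁿ` contains a closed Euclidean ball of
diameter `Θ(σ) · diam(σ)`, where `Θ(σ) = |σ| / diam(σ)ⁿ` is the fullness of `σ`. -/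
theorem parallelotope_contains_ball (n : ℕ) (x₀ : EuclideanSpace ℝ (Fin n))
    (v : Fin n → EuclideanSpace ℝ (Fin n)) (hv : LinearIndependent ℝ v)
    (σ : Set (EuclideanSpace ℝ (Fin n)))
    (hσ : σ = (fun lam : Fin n → ℝ => x₀ + ∑ i, lam i • v i) ''
      {lam | ∀ i, lam i ∈ Set.Icc (0:ℝ) 1}) :
    ∃ (c : EuclideanSpace ℝ (Fin n)) (r : ℝ), 0 ≤ r ∧ closedBall c r ⊆ σ ∧
      2 * r = (volume σ).toReal / diam σ ^ n * diam σ := by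
  refine ⟨x₀ + ∑ i, (1 / 2 : ℝ) • v i, (volume σ).toReal / diam σ ^ n * diam σ / 2, by positivity,
    ?_, by ring⟩
  have : Fact (Module.finrank ℝ (EuclideanSpace ℝ (Fin n)) = n) := ⟨by simp⟩
  let o : Orientation ℝ (EuclideanSpace ℝ (Fin n)) (Fin n) :=
    (EuclideanSpace.basisFun (Fin n) ℝ).toBasis.orientation
  let b : Module.Basis (Fin n) ℝ (EuclideanSpace ℝ (Fin n)) :=
    basisOfLinearIndependentOfCardEqFinrank' v hv (by simp)
  have hb : (b : Fin n → EuclideanSpace ℝ (Fin n)) = v := by simp [b]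
  have hvol : (volume σ).toReal = |o.volumeForm v| := by
    rw [hσ, o.volume_image_add_sum, ENNReal.toReal_ofReal (abs_nonneg _)]
  have hpos : 0 < |o.volumeForm v| := by
    rw [abs_pos, ← hb]
    refine (AlternatingMap.map_basis_ne_zero_iff b o.volumeForm).2 fun h0 => ?_
    simpa [h0] using o.abs_volumeForm_apply_of_orthonormal (EuclideanSpace.basisFun (Fin n) ℝ)
  have hbdd : Bornology.IsBounded σ := by
    have hset : {lam : Fin n → ℝ | ∀ i, lam i ∈ Set.Icc (0:ℝ) 1}
        = Set.pi Set.univ fun _ => Set.Icc 0 1 := by ext; simp only [Set.mem_ofPred_eq, Set.mem_univ_pi]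
    rw [hσ, hset]
    exact ((isCompact_univ_pi fun _ => isCompact_Icc).image (by fun_prop)).isBounded
  have hnorm (j : Fin n) : ‖v j‖ ≤ diam σ := by
    have h0 : x₀ ∈ σ := hσ ▸ ⟨0, by simp, by simp⟩
    have hj : x₀ + v j ∈ σ := by
      rw [hσ]
      refine ⟨Pi.single j 1, fun i => ?_, by simp [Pi.single_apply]⟩
      by_cases h : i = j <;> simp [h]
    simpa using dist_le_diam_of_mem hbdd hj h0
  intro y hy
  rw [mem_closedBall, dist_eq_norm] at hy
  set z := y - (x₀ + ∑ i, (1 / 2 : ℝ) • v i) with hz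
  have hcoord (i : Fin n) : |b.repr z i| ≤ 1 / 2 := by
    have hd : 0 < diam σ := (norm_pos_iff.2 (hv.ne_zero i)).trans_le (hnorm i)
    have hn : diam σ ^ n = diam σ ^ (n - 1) * diam σ := by
      rw [← pow_succ, Nat.sub_add_cancel i.pos]
    have hcramer := AlternatingMap.map_update_basis_eq_repr_mul o.volumeForm b i z
    have hhad := o.abs_volumeForm_apply_le (Function.update b i z)
    rw [hcramer, abs_mul, hb] at hhad
    have hprod : ∏ j, ‖Function.update v i z j‖ ≤ ‖z‖ * diam σ ^ (n - 1) := by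
      rw [← Finset.mul_prod_erase _ _ (Finset.mem_univ i), Function.update_self]
      gcongr
      calc ∏ j ∈ Finset.univ.erase i, ‖Function.update v i z j‖
          ≤ ∏ _j ∈ Finset.univ.erase i, diam σ := by
            refine Finset.prod_le_prod (fun _ _ => norm_nonneg _) fun j hj => ?_
            rw [Function.update_of_ne (Finset.ne_of_mem_erase hj)]
            exact hnorm j
        _ = diam σ ^ (n - 1) := by simp
    have hz' : ‖z‖ * diam σ ^ (n - 1) ≤ |o.volumeForm v| / 2 := by
      calc ‖z‖ * diam σ ^ (n - 1)
          ≤ (volume σ).toReal / diam σ ^ n * diam σ / 2 * diam σ ^ (n - 1) := by gcongr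
        _ = |o.volumeForm v| / 2 := by rw [hvol, hn]; field_simp
    refine le_of_mul_le_mul_right ?_ hpos
    linarith
  rw [hσ]
  refine ⟨fun i => 1 / 2 + b.repr z i, fun i => ?_, ?_⟩
  · have := abs_le.1 (hcoord i)
    constructor <;> linarith
  · have hsum : ∑ i, b.repr z i • v i = z := by
      rw [← hb]
      exact b.sum_repr z
    simp only [add_smul, Finset.sum_add_distrib, hsum]
    rw [hz]
    abel
end

section
/- Let φ : ℝⁿ → ℝⁿ be an affine bijection and let σ = φ([0,1]ⁿ) be the image of the unit n-cube, so that σ is an n-parallelotope. Then the linear part L of the inverse affine map φ⁻¹ satisfies the operator-norm bound ‖L‖ ≤ √n / (Θ(σ) · diam(σ)), where Θ(σ) = |σ| / diam(σ)ⁿ is the fullness of σ, |σ| its Lebesgue measure, and diam(σ) its Euclidean diameter. -/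
open Metric MeasureTheory

open Module in
/-- **Hadamard's inequality** for the determinant with respect to an orthonormal basis. -/
lemma OrthonormalBasis.abs_det_le_prod_norm {E : Type*} [NormedAddCommGroup E]
    [InnerProductSpace ℝ E] {n : ℕ} (b : OrthonormalBasis (Fin n) ℝ E) (v : Fin n → E) :
    |b.toBasis.det v| ≤ ∏ i, ‖v i‖ := by
  have : Fact (finrank ℝ E = n) := ⟨by simpa using finrank_eq_card_basis b.toBasis⟩
  rw [← b.toBasis.orientation.volumeForm_robust' b v]
  exact Orientation.abs_volumeForm_apply_le _ v

lemma Module.Basis.det_update_self {R M ι : Type*} [CommRing R] [AddCommGroup M] [Module R M]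
    [Fintype ι] [DecidableEq ι] (b : Module.Basis ι R M) (i : ι) (x : M) :
    b.det (Function.update b i x) = b.repr x i := by
  rw [b.det_apply, b.toMatrix_update, b.toMatrix_self, ← Matrix.cramer_apply, Matrix.cramer_one,
    Module.End.one_apply]

/-- If a linear map sends the vectors of an orthonormal basis to vectors of length at most `d`,
then its determinant bounds the coordinates of a vector in terms of the norm of its image. -/
lemma OrthonormalBasis.abs_det_mul_abs_repr_le {E : Type*} [NormedAddCommGroup E]
    [InnerProductSpace ℝ E] {n : ℕ} (b : OrthonormalBasis (Fin n) ℝ E) (A : E →ₗ[ℝ] E) {d : ℝ}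
    (hd : ∀ i, ‖A (b i)‖ ≤ d) (x : E) (i : Fin n) :
    |LinearMap.det A| * |b.repr x i| ≤ ‖A x‖ * d ^ (n - 1) := by
  have hdet : LinearMap.det A * b.repr x i =
      b.toBasis.det (A ∘ Function.update b i x) := by
    rw [b.toBasis.det_comp, ← b.coe_toBasis, Module.Basis.det_update_self,
      b.coe_toBasis_repr_apply]
  rw [← abs_mul, hdet]
  refine (b.abs_det_le_prod_norm _).trans ?_
  rw [← Finset.mul_prod_erase _ _ (Finset.mem_univ i)]
  simp only [Function.comp_apply, Function.update_self]
  gcongr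
  calc ∏ j ∈ Finset.univ.erase i, ‖A (Function.update b i x j)‖
      ≤ ∏ _j ∈ Finset.univ.erase i, d := by
        refine Finset.prod_le_prod (fun _ _ => norm_nonneg _) fun j hj => ?_
        rw [Function.update_of_ne (Finset.ne_of_mem_erase hj)]
        exact hd j
    _ = d ^ (n - 1) := by simp [Finset.card_erase_of_mem]

lemma EuclideanSpace.norm_le_sqrt_card_mul {ι : Type*} [Fintype ι] {x : EuclideanSpace ℝ ι}
    {c : ℝ} (hc : 0 ≤ c) (hx : ∀ i, |x i| ≤ c) : ‖x‖ ≤ √(Fintype.card ι) * c := by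
  rw [EuclideanSpace.norm_eq, ← Real.sqrt_sq hc, ← Real.sqrt_mul (Nat.cast_nonneg _)]
  refine Real.sqrt_le_sqrt ?_
  calc ∑ i, ‖x i‖ ^ 2 ≤ ∑ _i : ι, c ^ 2 := by
        gcongr with i
        exact hx i
    _ = Fintype.card ι * c ^ 2 := by simp

namespace EuclideanSpace

variable {ι : Type*}

lemma setOf_forall_mem_Icc_eq_preimage :
    {x : EuclideanSpace ℝ ι | ∀ i, x i ∈ Set.Icc (0 : ℝ) 1} =
      WithLp.ofLp ⁻¹' Set.univ.pi fun _ => Set.Icc (0 : ℝ) 1 := by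
  ext x
  simp only [Set.mem_ofPred_eq, Set.mem_preimage, Set.mem_univ_pi]

lemma isCompact_unitCube :
    IsCompact {x : EuclideanSpace ℝ ι | ∀ i, x i ∈ Set.Icc (0 : ℝ) 1} := by
  rw [setOf_forall_mem_Icc_eq_preimage]
  exact (PiLp.homeomorph 2 fun _ : ι => ℝ).isCompact_preimage.2
    (isCompact_univ_pi fun _ => isCompact_Icc)

lemma volume_unitCube [Fintype ι] :
    volume {x : EuclideanSpace ℝ ι | ∀ i, x i ∈ Set.Icc (0 : ℝ) 1} = 1 := by
  rw [setOf_forall_mem_Icc_eq_preimage,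
    (PiLp.volume_preserving_ofLp ι).measure_preimage
      (MeasurableSet.univ_pi fun _ => measurableSet_Icc).nullMeasurableSet, volume_pi_pi]
  simp

end EuclideanSpace

lemma AffineMap.addHaar_image {E : Type*} [NormedAddCommGroup E] [NormedSpace ℝ E]
    [MeasurableSpace E] [BorelSpace E] [FiniteDimensional ℝ E] (μ : Measure E)
    [μ.IsAddHaarMeasure] (f : E →ᵃ[ℝ] E) (s : Set E) :
    μ (f '' s) = ENNReal.ofReal |LinearMap.det f.linear| * μ s := by
  have : f '' s = (fun y => y + f 0) '' (f.linear '' s) := by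
    rw [Set.image_image]
    exact Set.image_congr fun x _ => congrFun f.decomp x
  rw [this, Set.image_add_right, measure_preimage_add_right, Measure.addHaar_image_linearMap]

/-- If `φ : ℝⁿ → ℝⁿ` is an affine bijection and `σ = φ([0,1]ⁿ)`, then the
linear part `L` of `φ⁻¹` satisfies `‖L‖ ≤ √n / (Θ(σ) · diam(σ))`, where
`Θ(σ) = |σ| / diam(σ)ⁿ` is the fullness of `σ`. -/
theorem inverse_affine_linear_part_bound (n : ℕ)
    (φ : EuclideanSpace ℝ (Fin n) ≃ᵃ[ℝ] EuclideanSpace ℝ (Fin n))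
    (σ : Set (EuclideanSpace ℝ (Fin n)))
    (hσ : σ = φ '' {x | ∀ i, x i ∈ Set.Icc (0:ℝ) 1}) :
    ‖(LinearMap.toContinuousLinearMap (φ.symm.linear) :
        EuclideanSpace ℝ (Fin n) →L[ℝ] EuclideanSpace ℝ (Fin n))‖ ≤
      Real.sqrt n / ((volume σ).toReal / diam σ ^ n * diam σ) := by
  let A : EuclideanSpace ℝ (Fin n) →ₗ[ℝ] EuclideanSpace ℝ (Fin n) := φ.linear
  have hvol : (volume σ).toReal = |LinearMap.det A| := by
    have := AffineMap.addHaar_image volume φ.toAffineMap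
      {x : EuclideanSpace ℝ (Fin n) | ∀ i, x i ∈ Set.Icc (0 : ℝ) 1}
    rw [EuclideanSpace.volume_unitCube, mul_one] at this
    rw [hσ]
    refine (congrArg ENNReal.toReal this).trans ?_
    rw [ENNReal.toReal_ofReal (abs_nonneg _)]
    rfl
  have hbdd : Bornology.IsBounded σ := by
    rw [hσ]
    exact (EuclideanSpace.isCompact_unitCube.image
      (AffineMap.continuous_of_finiteDimensional φ.toAffineMap)).isBounded
  let b := EuclideanSpace.basisFun (Fin n) ℝ
  have hedge : ∀ i, ‖A (b i)‖ ≤ diam σ := fun i => by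
    have h0 : φ 0 ∈ σ := hσ ▸ Set.mem_image_of_mem _ (by simp)
    have h1 : φ (b i) ∈ σ := hσ ▸ Set.mem_image_of_mem _ (fun j => by
      by_cases h : j = i <;> simp [b, h])
    have := dist_le_diam_of_mem hbdd h1 h0
    rwa [dist_eq_norm_vsub (EuclideanSpace ℝ (Fin n)), ← AffineEquiv.coe_toAffineMap,
      ← AffineMap.linearMap_vsub, vsub_eq_sub, sub_zero] at this
  have hdet : 0 < |LinearMap.det A| :=
    abs_pos.2 φ.linear.isUnit_det'.ne_zero
  rcases Nat.eq_zero_or_pos n with rfl | hn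
  · simp [Subsingleton.elim (LinearMap.toContinuousLinearMap _) 0]
  have hd : 0 < diam σ := by
    refine lt_of_lt_of_le (norm_pos_iff.2 ?_) (hedge ⟨0, hn⟩)
    exact (map_ne_zero_iff A φ.linear.injective).2 (b.orthonormal.ne_zero _)
  rw [hvol]
  have hrhs : √n / (|LinearMap.det A| / diam σ ^ n * diam σ) =
      √n * (diam σ ^ (n - 1) / |LinearMap.det A|) := by
    rw [← pow_sub_one_mul hn.ne' (diam σ)]
    field_simp
  rw [hrhs]
  refine ContinuousLinearMap.opNorm_le_bound _ (by positivity) fun y => ?_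
  rw [mul_assoc]
  have := EuclideanSpace.norm_le_sqrt_card_mul (x := φ.symm.linear y)
    (c := diam σ ^ (n - 1) / |LinearMap.det A| * ‖y‖) (by positivity)
    fun i => by
      have := b.abs_det_mul_abs_repr_le A hedge (φ.symm.linear y) i
      have hy : A (φ.symm.linear y) = y := φ.linear.apply_symm_apply y
      rw [hy] at this
      rw [div_mul_eq_mul_div, le_div_iff₀' hdet, mul_comm (diam σ ^ _)]
      exact this
  simpa using this
end

section
/- Let n ≥ 1, 0 ≤ p ≤ n, integers k ≥ 0 and k' ≥ 0, I ⊆ {1,…,n} with |I| = p, exponents 𝐤 ∈ ℕⁿ with k_i ≤ k for all i, offsets 𝐤′ ∈ ℕⁿ with k′_i ≤ k′ for all i, and y_i ∈ {0,1} for each i ∉ I. Then the average over the small cube υ — that is, (k′+1)^p times the p-dimensional Lebesgue integral over the set { x : k′_i/(k′+1) ≤ x_i ≤ (k′_i+1)/(k′+1) for i ∈ I, x_i = (k′_i + y_i)/(k′+1) for i ∉ I } — of the function ∏_{i=1}^{n} x_i^{k_i} (1 − x_i)^{k − k_i} equals (1/(k′+1)^{nk}) · ∏_{i ∉ I} (k′_i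 + y_i)^{k_i} (k′ − k′_i + 1 − y_i)^{k − k_i} · ∏_{i ∈ I} ∫₀¹ (k′_i + x)^{k_i} (k′ − k′_i + 1 − x)^{k − k_i} dx. -/
open MeasureTheory

/-- The Bernstein-type factor at `t / m`, cleared of denominators. -/
lemma div_pow_mul_one_sub_div_pow {m : ℝ} (hm : m ≠ 0) {a k : ℕ} (ha : a ≤ k) (t : ℝ) :
    (t / m) ^ a * (1 - t / m) ^ (k - a) = (1 / m ^ k) * (t ^ a * (m - t) ^ (k - a)) := by
  rw [one_sub_div hm, div_pow, div_pow, div_mul_div_comm, ← pow_add, Nat.add_sub_cancel' ha,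
    one_div_mul_eq_div]

/-- The substitution `u = (c + x) / m` in the one-variable factor. -/
lemma mul_setIntegral_Icc_pow_mul_one_sub_pow {m : ℝ} (hm : 0 < m) {a k : ℕ} (ha : a ≤ k)
    (c : ℝ) :
    m * ∫ u in Set.Icc (c / m) ((c + 1) / m), u ^ a * (1 - u) ^ (k - a) =
      (1 / m ^ k) * ∫ x in (0 : ℝ)..1, (c + x) ^ a * (m - (c + x)) ^ (k - a) := by
  have hle : c / m ≤ (c + 1) / m := by gcongr; linarith
  have hdiv := intervalIntegral.integral_comp_div (a := c) (b := c + 1)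
    (fun u : ℝ => u ^ a * (1 - u) ^ (k - a)) hm.ne'
  rw [integral_Icc_eq_integral_Ioc, ← intervalIntegral.integral_of_le hle, ← smul_eq_mul, ← hdiv]
  simp_rw [div_pow_mul_one_sub_div_pow hm.ne' ha]
  rw [intervalIntegral.integral_const_mul]
  congr 1
  have hadd := intervalIntegral.integral_comp_add_left (a := 0) (b := 1)
    (fun t : ℝ => t ^ a * (m - t) ^ (k - a)) c
  rw [hadd, add_zero]

/-- Integrating over a box a product of one-variable functions, with the coordinates outside
`I` fixed at `z`. -/
lemma setIntegral_prod_dite_eq {ι : Type*} [Fintype ι] [DecidableEq ι] (I : Finset ι)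
    (s : ι → Set ℝ) (f : ι → ℝ → ℝ) (z : ι → ℝ) :
    ∫ x : {i // i ∈ I} → ℝ in Set.univ.pi fun j => s j.1,
        ∏ i, f i (if h : i ∈ I then x ⟨i, h⟩ else z i) =
      (∏ i ∈ Iᶜ, f i (z i)) * ∏ i ∈ I, ∫ t in s i, f i t := by
  have hsplit (x : {i // i ∈ I} → ℝ) :
      ∏ i, f i (if h : i ∈ I then x ⟨i, h⟩ else z i) =
        (∏ i ∈ Iᶜ, f i (z i)) * ∏ j : {i // i ∈ I}, f j.1 (x j) := by
    rw [← Finset.prod_compl_mul_prod I]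
    congr 1
    · refine Finset.prod_congr rfl fun i hi => ?_
      rw [dif_neg (Finset.mem_compl.mp hi)]
    · rw [← Finset.prod_coe_sort I]
      refine Finset.prod_congr rfl fun j _ => ?_
      rw [dif_pos j.2]
  simp_rw [hsplit]
  rw [integral_const_mul, volume_pi, Measure.restrict_pi_pi,
    integral_fintype_prod_eq_prod (fun (j : {i // i ∈ I}) t => f j.1 t),
    Finset.prod_coe_sort I fun i => ∫ t in s i, f i t]

/-- The average over the small `p`-cube
`υ = {x : k′ᵢ/(k′+1) ≤ xᵢ ≤ (k′ᵢ+1)/(k′+1) for i ∈ I, xᵢ = (k′ᵢ + yᵢ)/(k′+1) for i ∉ I}` —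
i.e. `(k′+1)^p` times the `p`-dimensional Lebesgue integral over `υ` — of
`∏ᵢ xᵢ^{kᵢ} (1 − xᵢ)^{k − kᵢ}` equals
`(1/(k′+1)^{nk}) · ∏_{i∉I} (k′ᵢ + yᵢ)^{kᵢ} (k′ − k′ᵢ + 1 − yᵢ)^{k − kᵢ}
  · ∏_{i∈I} ∫₀¹ (k′ᵢ + x)^{kᵢ} (k′ − k′ᵢ + 1 − x)^{k − kᵢ} dx`. -/
theorem average_over_small_cube (n p k k' : ℕ) (hn : 1 ≤ n) (hp : p ≤ n)
    (I : Finset (Fin n)) (hI : I.card = p)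
    (kk : Fin n → ℕ) (hkk : ∀ i, kk i ≤ k)
    (kp : Fin n → ℕ) (hkp : ∀ i, kp i ≤ k')
    (y : Fin n → ℝ) (hy : ∀ i ∉ I, y i = 0 ∨ y i = 1) :
    ((k' : ℝ) + 1) ^ p *
      ∫ x : {i // i ∈ I} → ℝ in
        {x | ∀ j : {i // i ∈ I},
          (kp j.1 : ℝ) / (k' + 1) ≤ x j ∧ x j ≤ ((kp j.1 : ℝ) + 1) / (k' + 1)},
        ∏ i : Fin n,
          (if h : i ∈ I then x ⟨i, h⟩ else ((kp i : ℝ) + y i) / (k' + 1)) ^ (kk i) *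
          (1 - if h : i ∈ I then x ⟨i, h⟩ else ((kp i : ℝ) + y i) / (k' + 1)) ^ (k - kk i) =
    (1 / ((k' : ℝ) + 1) ^ (n * k)) *
      (∏ i ∈ Iᶜ, ((kp i : ℝ) + y i) ^ (kk i) *
        ((k' : ℝ) - (kp i : ℝ) + 1 - y i) ^ (k - kk i)) *
      ∏ i ∈ I, ∫ x in (0:ℝ)..1,
        ((kp i : ℝ) + x) ^ (kk i) * ((k' : ℝ) - (kp i : ℝ) + 1 - x) ^ (k - kk i) := by
  have hm : (0 : ℝ) < k' + 1 := by positivity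
  have hbox : {x : {i // i ∈ I} → ℝ | ∀ j : {i // i ∈ I},
      (kp j.1 : ℝ) / (k' + 1) ≤ x j ∧ x j ≤ ((kp j.1 : ℝ) + 1) / (k' + 1)} =
      Set.univ.pi fun j : {i // i ∈ I} =>
        Set.Icc ((kp j.1 : ℝ) / (k' + 1)) (((kp j.1 : ℝ) + 1) / (k' + 1)) := by
    ext x
    simp only [Set.mem_ofPred_eq, Set.mem_univ_pi, Set.mem_Icc]
  rw [hbox, setIntegral_prod_dite_eq I
    (fun i => Set.Icc ((kp i : ℝ) / (k' + 1)) (((kp i : ℝ) + 1) / (k' + 1)))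
    (fun i t => t ^ kk i * (1 - t) ^ (k - kk i)) fun i => ((kp i : ℝ) + y i) / (k' + 1)]
  rw [mul_left_comm, ← hI, ← Finset.prod_const, ← Finset.prod_mul_distrib]
  simp_rw [mul_setIntegral_Icc_pow_mul_one_sub_pow hm (hkk _),
    div_pow_mul_one_sub_div_pow hm.ne' (hkk _)]
  have hpow : (1 / ((k' : ℝ) + 1) ^ k) ^ Iᶜ.card * (1 / ((k' : ℝ) + 1) ^ k) ^ I.card =
      1 / ((k' : ℝ) + 1) ^ (n * k) := by
    rw [← pow_add, Finset.card_compl_add_card, Fintype.card_fin, one_div_pow, ← pow_mul,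
      mul_comm k n]
  have hsub (i : Fin n) (t : ℝ) :
      (k' : ℝ) + 1 - ((kp i : ℝ) + t) = (k' : ℝ) - (kp i : ℝ) + 1 - t := by ring
  simp_rw [hsub, Finset.prod_mul_distrib, Finset.prod_const]
  rw [← hpow]
  ring
end
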